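/- Let D be a nonempty subset of ℝⁿ, Π_D a metric projection onto D, and Δ_f : ℝⁿ → ℝⁿ a map such that x ↦ x − Δ_f(x) is L-Lipschitz with L < 1/2. Let x⋆ ∈ D satisfy Δ_f(x⋆) = 0, and define the iterates x_{t+1} = Π_D(x_t − Δ_f(x_t)) from an arbitrary x_0 ∈ ℝⁿ. Then the sequence (x_t) converges to x⋆ as t → ∞. -/

import Mathlib

open scoped NNReal

/-- Projected gradient-type iterations `x_{t+1} = Π_D (x_t - Δ_f x_t)`, where `Π_D` is a
metric projection onto a nonempty set `D ⊆ ℝⁿ`, `x ↦ x - Δ_f x` is `L`-Lipschitz with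
`L < 1/2`, and `x⋆ ∈ D` satisfies `Δ_f x⋆ = 0`, converge to `x⋆`. -/
theorem projected_iterates_tendsto
    {n : ℕ}
    (D : Set (EuclideanSpace ℝ (Fin n))) (hD : D.Nonempty)
    (proj : EuclideanSpace ℝ (Fin n) → EuclideanSpace ℝ (Fin n))
    (hproj_mem : ∀ z, proj z ∈ D)
    (hproj_min : ∀ z, ∀ x ∈ D, ‖proj z - z‖ ≤ ‖x - z‖)
    (Δf : EuclideanSpace ℝ (Fin n) → EuclideanSpace ℝ (Fin n))
    (L : ℝ≥0)
    (hLip : LipschitzWith L (fun x => x - Δf x))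
    (hL : (L : ℝ) < 1 / 2)
    (xstar : EuclideanSpace ℝ (Fin n)) (hxstar : xstar ∈ D)
    (hstat : Δf xstar = 0)
    (x : ℕ → EuclideanSpace ℝ (Fin n))
    (hiter : ∀ t, x (t + 1) = proj (x t - Δf (x t))) :
    Filter.Tendsto x Filter.atTop (nhds xstar) := by
  have step : ∀ t, ‖x (t + 1) - xstar‖ ≤ (2 * (L : ℝ)) * ‖x t - xstar‖ := by
    intro t
    have h1 := hproj_min (x t - Δf (x t)) xstar hxstar
    have h2 := hLip.dist_le_mul (x t) xstar
    simp only [hstat, sub_zero, dist_eq_norm] at h2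
    rw [norm_sub_rev xstar] at h1
    have h3 := norm_add_le (proj (x t - Δf (x t)) - (x t - Δf (x t)))
      ((x t - Δf (x t)) - xstar)
    rw [sub_add_sub_cancel] at h3
    rw [hiter t]
    linarith
  have bound : ∀ t, ‖x t - xstar‖ ≤ (2 * (L : ℝ)) ^ t * ‖x 0 - xstar‖ := by
    intro t
    induction t with
    | zero => simp
    | succ k ih =>
      calc ‖x (k + 1) - xstar‖ ≤ (2 * (L : ℝ)) * ‖x k - xstar‖ := step k
        _ ≤ (2 * (L : ℝ)) * ((2 * (L : ℝ)) ^ k * ‖x 0 - xstar‖) := by gcongr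
        _ = (2 * (L : ℝ)) ^ (k + 1) * ‖x 0 - xstar‖ := by ring
  rw [tendsto_iff_norm_sub_tendsto_zero]
  have h0 : (0 : ℝ) ≤ 2 * (L : ℝ) := by positivity
  have hlim := (tendsto_pow_atTop_nhds_zero_of_lt_one h0 (by linarith)).mul_const
    ‖x 0 - xstar‖
  rw [zero_mul] at hlim
  exact squeeze_zero (fun t => norm_nonneg _) bound hlim
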